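/- (Randomized compilation of a sequence of multiplexed rotations.) Let c, n ≥ 1, let θ : Fin n → Fin c → ℝ be rotation angles, let V : Fin n → Matrix (Fin c × Fin 2) (Fin c × Fin 2) ℂ be unitary matrices, and let b be an integer with b ≥ 1. For each k let U_k = Matrix.blockDiagonal (fun j => Rz(θ_{k,j})) and let Ū_k = Matrix.blockDiagonal (fun j => (1 − r(θ_{k,j},b))·Rz(φ₀(θ_{k,j},b)) + r(θ_{k,j},b)·Rz(φ₀(θ_{k,j},b) + 2^{−b})) be the expectation of its randomized b-bit rounding. Then ‖(U_{n−1}V_{n−1})···(U_0V_0) − (Ū_{n−1}V_{n−1})···(Ū_0V_0)‖ ≤ n·π²·2^{−(2b+1)}. Consequently, for any ε with 0 < ε ≤ n·π²/8, choosing b = ⌈(1/2)·log₂(n·π²/(2ε))⌉ gives a bound of ε. -/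

import Mathlib

open Real

/-- The ℓ²→ℓ² operator norm of a square complex matrix. -/
noncomputable def opNorm {n : Type*} [Fintype n] [DecidableEq n] (M : Matrix n n ℂ) : ℝ :=
  ‖Matrix.toEuclideanCLM (𝕜 := ℂ) M‖

/-- The ordered product `F (n−1) * ⋯ * F 0` (factors in decreasing index order). -/
noncomputable def prodDesc {n : ℕ} {ι : Type*} [Fintype ι] [DecidableEq ι]
    (F : Fin n → Matrix ι ι ℂ) : Matrix ι ι ℂ :=
  ((List.ofFn F).reverse).prod

/-- The single-qubit rotation `Rz(φ) = diag(e^{2πiφ}, e^{−2πiφ})`. -/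
noncomputable def Rz (φ : ℝ) : Matrix (Fin 2) (Fin 2) ℂ :=
  Matrix.diagonal ![Complex.exp (2 * Real.pi * Complex.I * (φ : ℂ)),
    Complex.exp (-(2 * Real.pi * Complex.I * (φ : ℂ)))]

/-- The `b`-bit truncation `φ₀(θ,b) = 2^{−b}·⌊2^b·θ⌋`. -/
noncomputable def phi0 (θ : ℝ) (b : ℕ) : ℝ :=
  (2 : ℝ) ^ (-(b : ℤ)) * (⌊(2 : ℝ) ^ b * θ⌋ : ℝ)

/-- The fractional remainder `r(θ,b) = 2^b·θ − ⌊2^b·θ⌋ ∈ [0,1)`. -/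
noncomputable def rfrac (θ : ℝ) (b : ℕ) : ℝ :=
  (2 : ℝ) ^ b * θ - (⌊(2 : ℝ) ^ b * θ⌋ : ℝ)

/-- The expectation of the randomized `b`-bit rounding of the rotation `Rz(θ)`. -/
noncomputable def expRz (θ : ℝ) (b : ℕ) : Matrix (Fin 2) (Fin 2) ℂ :=
  ((1 - rfrac θ b : ℝ) : ℂ) • Rz (phi0 θ b) +
    ((rfrac θ b : ℝ) : ℂ) • Rz (phi0 θ b + (2 : ℝ) ^ (-(b : ℤ)))

/-- The multiplexed rotation `U_k` with angles `θ k`. -/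
noncomputable def multiplexU {c : ℕ} (θ : Fin c → ℝ) :
    Matrix (Fin 2 × Fin c) (Fin 2 × Fin c) ℂ :=
  Matrix.blockDiagonal fun j => Rz (θ j)

/-- The expectation `Ū_k` of the randomized `b`-bit rounding of the multiplexed
rotation with angles `θ k`. -/
noncomputable def multiplexUbar {c : ℕ} (θ : Fin c → ℝ) (b : ℕ) :
    Matrix (Fin 2 × Fin c) (Fin 2 × Fin c) ℂ :=
  Matrix.blockDiagonal fun j => expRz (θ j) b

lemma exp_rem_aux (x : ℝ) :
    ‖Complex.exp (Complex.I * (x : ℂ)) - 1 - Complex.I * (x : ℂ)‖ ≤ x ^ 2 / 2 := by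
  have hder : ∀ t : ℝ, HasDerivAt
      (fun t : ℝ => Complex.exp (Complex.I * ((x * t : ℝ) : ℂ)) - 1 - Complex.I * ((x * t : ℝ) : ℂ))
      (Complex.I * (x : ℂ) * (Complex.exp (Complex.I * ((x * t : ℝ) : ℂ)) - 1)) t := by
    intro t
    have h1 : HasDerivAt (fun t : ℝ => x * t) x t := by
      simpa using (hasDerivAt_id t).const_mul x
    have h2 : HasDerivAt (fun t : ℝ => Complex.I * ((x * t : ℝ) : ℂ)) (Complex.I * (x : ℂ)) t :=
      (h1.ofReal_comp).const_mul Complex.I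
    have h3 := ((h2.cexp).sub_const 1).sub h2
    refine HasDerivAt.congr_deriv h3 ?_
    ring
  have hB : ∀ t : ℝ, HasDerivAt (fun t : ℝ => x ^ 2 * t ^ 2 / 2) (x ^ 2 * t) t := by
    intro t
    have := (((hasDerivAt_id t).pow 2).const_mul (x ^ 2)).div_const 2
    refine HasDerivAt.congr_deriv this ?_
    simp
    ring
  have key := image_norm_le_of_norm_deriv_right_le_deriv_boundary (a := 0) (b := 1)
    (f := fun t : ℝ =>
      Complex.exp (Complex.I * ((x * t : ℝ) : ℂ)) - 1 - Complex.I * ((x * t : ℝ) : ℂ))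
    (fun t _ => (hder t).continuousAt.continuousWithinAt)
    (fun t _ => (hder t).hasDerivWithinAt) (by simp) hB
    (by
      intro t ht
      have h := Real.norm_exp_I_mul_ofReal_sub_one_le (x := x * t)
      rw [norm_mul, norm_mul, Complex.norm_I, one_mul, Complex.norm_real]
      calc ‖x‖ * _ ≤ ‖x‖ * ‖x * t‖ := mul_le_mul_of_nonneg_left h (norm_nonneg _)
        _ = x ^ 2 * t := by
          rw [norm_mul, Real.norm_of_nonneg ht.1, Real.norm_eq_abs, ← mul_assoc, ← sq, sq_abs])
  have := key (x := 1) (by simp)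
  simpa using this

lemma interp_aux (a d r : ℝ) (h0 : 0 ≤ r) (h1 : r ≤ 1) :
    ‖Complex.exp (Complex.I * ((a + r * d : ℝ) : ℂ)) -
      (((1 - r : ℝ) : ℂ) * Complex.exp (Complex.I * (a : ℂ)) +
        (r : ℂ) * Complex.exp (Complex.I * ((a + d : ℝ) : ℂ)))‖ ≤ d ^ 2 / 8 := by
  set x : ℝ := -(r * d) with hx
  set y : ℝ := (1 - r) * d with hy
  have hfac : Complex.exp (Complex.I * ((a + r * d : ℝ) : ℂ)) -
      (((1 - r : ℝ) : ℂ) * Complex.exp (Complex.I * (a : ℂ)) +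
        (r : ℂ) * Complex.exp (Complex.I * ((a + d : ℝ) : ℂ))) =
      -(Complex.exp (Complex.I * ((a + r * d : ℝ) : ℂ)) *
        (((1 - r : ℝ) : ℂ) * (Complex.exp (Complex.I * (x : ℂ)) - 1 - Complex.I * (x : ℂ)) +
          (r : ℂ) * (Complex.exp (Complex.I * (y : ℂ)) - 1 - Complex.I * (y : ℂ)))) := by
    have e1 : Complex.exp (Complex.I * (a : ℂ)) =
        Complex.exp (Complex.I * ((a + r * d : ℝ) : ℂ)) * Complex.exp (Complex.I * (x : ℂ)) := by
      rw [← Complex.exp_add, hx]; congr 1; push_cast; ring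
    have e2 : Complex.exp (Complex.I * ((a + d : ℝ) : ℂ)) =
        Complex.exp (Complex.I * ((a + r * d : ℝ) : ℂ)) * Complex.exp (Complex.I * (y : ℂ)) := by
      rw [← Complex.exp_add, hy]; congr 1; push_cast; ring
    rw [e1, e2, hx, hy]; push_cast; ring
  rw [hfac, norm_neg, norm_mul, Complex.norm_exp_I_mul_ofReal, one_mul]
  refine (norm_add_le _ _).trans ?_
  rw [norm_mul, norm_mul, Complex.norm_real, Complex.norm_real, Real.norm_of_nonneg h0,
    Real.norm_of_nonneg (sub_nonneg.2 h1)]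
  have k1 := mul_le_mul_of_nonneg_left (exp_rem_aux x) (sub_nonneg.2 h1)
  have k2 := mul_le_mul_of_nonneg_left (exp_rem_aux y) h0
  have k3 : (1 - r) * (x ^ 2 / 2) + r * (y ^ 2 / 2) ≤ d ^ 2 / 8 := by
    have : d ^ 2 / 8 - ((1 - r) * (x ^ 2 / 2) + r * (y ^ 2 / 2)) = (d * (1 - 2 * r)) ^ 2 / 8 := by
      rw [hx, hy]; ring
    nlinarith [sq_nonneg (d * (1 - 2 * r))]
  linarith

lemma rfrac_mem (θ : ℝ) (b : ℕ) : 0 ≤ rfrac θ b ∧ rfrac θ b ≤ 1 := by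
  unfold rfrac
  exact ⟨by linarith [Int.floor_le ((2 : ℝ) ^ b * θ)],
    by linarith [Int.lt_floor_add_one ((2 : ℝ) ^ b * θ)]⟩

lemma theta_eq (θ : ℝ) (b : ℕ) : θ = phi0 θ b + rfrac θ b * (2 : ℝ) ^ (-(b : ℤ)) := by
  unfold phi0 rfrac
  rw [zpow_neg, zpow_natCast]
  field_simp
  ring

/-- diagonal entries of the rotation -/
noncomputable def rzv (φ : ℝ) : Fin 2 → ℂ :=
  ![Complex.exp (Complex.I * ((2 * Real.pi * φ : ℝ) : ℂ)),
    Complex.exp (Complex.I * ((-(2 * Real.pi * φ) : ℝ) : ℂ))]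

/-- diagonal entries of the averaged rotation -/
noncomputable def erzv (θ : ℝ) (b : ℕ) : Fin 2 → ℂ :=
  ((1 - rfrac θ b : ℝ) : ℂ) • rzv (phi0 θ b) +
    ((rfrac θ b : ℝ) : ℂ) • rzv (phi0 θ b + (2 : ℝ) ^ (-(b : ℤ)))

lemma Rz_eq (φ : ℝ) : Rz φ = Matrix.diagonal (rzv φ) := by
  unfold Rz rzv
  have e1 : 2 * (Real.pi : ℂ) * Complex.I * (φ : ℂ) =
      Complex.I * ((2 * Real.pi * φ : ℝ) : ℂ) := by push_cast; ring
  have e2 : -(Complex.I * ((2 * Real.pi * φ : ℝ) : ℂ)) =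
      Complex.I * ((-(2 * Real.pi * φ) : ℝ) : ℂ) := by push_cast; ring
  rw [e1, e2]

lemma expRz_eq (θ : ℝ) (b : ℕ) : expRz θ b = Matrix.diagonal (erzv θ b) := by
  unfold expRz erzv
  rw [Rz_eq, Rz_eq, ← Matrix.diagonal_smul, ← Matrix.diagonal_smul, Matrix.diagonal_add]
  rfl

lemma multiplexU_eq {c : ℕ} (θ : Fin c → ℝ) :
    multiplexU θ = Matrix.diagonal fun p : Fin 2 × Fin c => rzv (θ p.2) p.1 := by
  unfold multiplexU
  simp_rw [Rz_eq]
  exact Matrix.blockDiagonal_diagonal _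

lemma multiplexUbar_eq {c : ℕ} (θ : Fin c → ℝ) (b : ℕ) :
    multiplexUbar θ b = Matrix.diagonal fun p : Fin 2 × Fin c => erzv (θ p.2) b p.1 := by
  unfold multiplexUbar
  simp_rw [expRz_eq]
  exact Matrix.blockDiagonal_diagonal _

lemma norm_rzv (φ : ℝ) (i : Fin 2) : ‖rzv φ i‖ = 1 := by
  unfold rzv
  fin_cases i
  · exact Complex.norm_exp_I_mul_ofReal _
  · exact Complex.norm_exp_I_mul_ofReal _

lemma norm_erzv (θ : ℝ) (b : ℕ) (i : Fin 2) : ‖erzv θ b i‖ ≤ 1 := by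
  obtain ⟨h0, h1⟩ := rfrac_mem θ b
  unfold erzv
  rw [Pi.add_apply, Pi.smul_apply, Pi.smul_apply]
  refine (norm_add_le _ _).trans ?_
  rw [norm_smul, norm_smul, norm_rzv, norm_rzv, Complex.norm_real, Complex.norm_real,
    Real.norm_of_nonneg h0, Real.norm_of_nonneg (sub_nonneg.2 h1)]
  linarith

lemma pow_aux (b : ℕ) : (2 * Real.pi * (2 : ℝ) ^ (-(b : ℤ))) ^ 2 / 8 =
    Real.pi ^ 2 * (2 : ℝ) ^ (-(2 * (b : ℤ) + 1)) := by
  have : (2 : ℝ) ^ (-(2 * (b : ℤ) + 1)) = ((2 : ℝ) ^ (-(b : ℤ))) ^ 2 / 2 := by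
    rw [show (-(2 * (b : ℤ) + 1)) = -(b : ℤ) + -(b : ℤ) + (-1) by ring,
      zpow_add₀ two_ne_zero, zpow_add₀ two_ne_zero, zpow_neg_one]
    ring
  rw [this]; ring

lemma norm_rzv_sub (θ : ℝ) (b : ℕ) (i : Fin 2) :
    ‖rzv θ i - erzv θ b i‖ ≤ Real.pi ^ 2 * (2 : ℝ) ^ (-(2 * (b : ℤ) + 1)) := by
  obtain ⟨h0, h1⟩ := rfrac_mem θ b
  have ht := theta_eq θ b
  rw [← pow_aux]
  unfold erzv
  generalize rfrac θ b = r at *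
  generalize phi0 θ b = p at *
  generalize (2 : ℝ) ^ (-(b : ℤ)) = w at *
  subst ht
  fin_cases i
  · have := interp_aux (2 * Real.pi * p) (2 * Real.pi * w) r h0 h1
    rw [show 2 * Real.pi * p + r * (2 * Real.pi * w) = 2 * Real.pi * (p + r * w) by ring,
      show 2 * Real.pi * p + 2 * Real.pi * w = 2 * Real.pi * (p + w) by ring] at this
    exact this
  · have := interp_aux (-(2 * Real.pi * p)) (-(2 * Real.pi * w)) r h0 h1
    rw [show -(2 * Real.pi * p) + r * (-(2 * Real.pi * w)) = -(2 * Real.pi * (p + r * w)) by ring,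
      show -(2 * Real.pi * p) + -(2 * Real.pi * w) = -(2 * Real.pi * (p + w)) by ring,
      neg_sq] at this
    exact this

section Norms
open scoped Matrix.Norms.L2Operator

lemma opNorm_eq {ι : Type*} [Fintype ι] [DecidableEq ι] (M : Matrix ι ι ℂ) : opNorm M = ‖M‖ := rfl

lemma norm_diag_le {ι : Type*} [Fintype ι] [DecidableEq ι] (v : ι → ℂ) (C : ℝ) (hC : 0 ≤ C)
    (h : ∀ i, ‖v i‖ ≤ C) : ‖(Matrix.diagonal v : Matrix ι ι ℂ)‖ ≤ C := by
  rw [Matrix.l2_opNorm_diagonal]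
  exact (pi_norm_le_iff_of_nonneg hC).2 h

lemma norm_one_le_aux {ι : Type*} [Fintype ι] [DecidableEq ι] : ‖(1 : Matrix ι ι ℂ)‖ ≤ 1 := by
  rw [← Matrix.diagonal_one]
  exact norm_diag_le _ 1 zero_le_one (by simp)

lemma norm_unitary_le {ι : Type*} [Fintype ι] [DecidableEq ι] (V : Matrix ι ι ℂ)
    (h : V ∈ Matrix.unitaryGroup ι ℂ) : ‖V‖ ≤ 1 := by
  have h1 : star V * V = 1 := (Matrix.mem_unitaryGroup_iff').1 h
  have h2 := Matrix.l2_opNorm_conjTranspose_mul_self V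
  rw [← Matrix.star_eq_conjTranspose, h1] at h2
  have h3 := norm_one_le_aux (ι := ι)
  nlinarith [norm_nonneg V]

lemma prodDesc_succ {n : ℕ} {ι : Type*} [Fintype ι] [DecidableEq ι]
    (F : Fin (n + 1) → Matrix ι ι ℂ) : prodDesc F = prodDesc (fun k => F k.succ) * F 0 := by
  unfold prodDesc
  rw [List.ofFn_succ, List.reverse_cons, List.prod_append, List.prod_singleton]

lemma norm_prodDesc_le {n : ℕ} {ι : Type*} [Fintype ι] [DecidableEq ι]
    (F : Fin n → Matrix ι ι ℂ) (h : ∀ k, ‖F k‖ ≤ 1) : ‖prodDesc F‖ ≤ 1 := by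
  induction n with
  | zero => simpa [prodDesc] using norm_one_le_aux (ι := ι)
  | succ n ih =>
    rw [prodDesc_succ]
    exact (norm_mul_le _ _).trans
      (mul_le_one₀ (ih _ fun k => h k.succ) (norm_nonneg _) (h 0))

lemma telescope {n : ℕ} {ι : Type*} [Fintype ι] [DecidableEq ι]
    (F G : Fin n → Matrix ι ι ℂ) (hF : ∀ k, ‖F k‖ ≤ 1) (hG : ∀ k, ‖G k‖ ≤ 1) (δ : ℝ)
    (h : ∀ k, ‖F k - G k‖ ≤ δ) : ‖prodDesc F - prodDesc G‖ ≤ n * δ := by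
  induction n with
  | zero => simp [prodDesc]
  | succ n ih =>
    rw [prodDesc_succ, prodDesc_succ]
    set P := prodDesc (fun k => F k.succ)
    set Q := prodDesc (fun k => G k.succ) with hQ
    have e : P * F 0 - Q * G 0 = (P - Q) * F 0 + Q * (F 0 - G 0) := by noncomm_ring
    have i1 : ‖P - Q‖ ≤ n * δ :=
      ih _ _ (fun k => hF k.succ) (fun k => hG k.succ) (fun k => h k.succ)
    have i2 : ‖Q‖ ≤ 1 := norm_prodDesc_le _ fun k => hG k.succ
    have j1 : ‖(P - Q) * F 0‖ ≤ n * δ :=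
      (norm_mul_le _ _).trans ((mul_le_of_le_one_right (norm_nonneg _) (hF 0)).trans i1)
    have j2 : ‖Q * (F 0 - G 0)‖ ≤ δ :=
      (norm_mul_le _ _).trans ((mul_le_of_le_one_left (norm_nonneg _) i2).trans (h 0))
    rw [e]
    refine (norm_add_le _ _).trans ?_
    push_cast
    linarith

lemma main_bound (c n : ℕ) (θ : Fin n → Fin c → ℝ)
    (V : Fin n → Matrix (Fin 2 × Fin c) (Fin 2 × Fin c) ℂ)
    (hV : ∀ k, V k ∈ Matrix.unitaryGroup (Fin 2 × Fin c) ℂ) (b : ℕ) :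
    opNorm (prodDesc (fun k => multiplexU (θ k) * V k) -
          prodDesc (fun k => multiplexUbar (θ k) b * V k)) ≤
        (n : ℝ) * Real.pi ^ 2 * (2 : ℝ) ^ (-(2 * (b : ℤ) + 1)) := by
  rw [opNorm_eq, mul_assoc]
  have hv := fun k => norm_unitary_le (V k) (hV k)
  apply telescope
  · intro k
    refine (norm_mul_le _ _).trans (mul_le_one₀ ?_ (norm_nonneg _) (hv k))
    rw [multiplexU_eq]
    exact norm_diag_le _ 1 zero_le_one fun p => (norm_rzv _ _).le
  · intro k
    refine (norm_mul_le _ _).trans (mul_le_one₀ ?_ (norm_nonneg _) (hv k))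
    rw [multiplexUbar_eq]
    exact norm_diag_le _ 1 zero_le_one fun p => norm_erzv _ _ _
  · intro k
    rw [← sub_mul]
    refine (norm_mul_le _ _).trans
      ((mul_le_of_le_one_right (norm_nonneg _) (hv k)).trans ?_)
    rw [multiplexU_eq, multiplexUbar_eq, Matrix.diagonal_sub]
    exact norm_diag_le _ _ (by positivity) fun p => norm_rzv_sub _ _ _

end Norms

theorem randomized_sequence_of_multiplexed_rotations (c n : ℕ) (hc : 1 ≤ c) (hn : 1 ≤ n)
    (θ : Fin n → Fin c → ℝ)
    (V : Fin n → Matrix (Fin 2 × Fin c) (Fin 2 × Fin c) ℂ)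
    (hV : ∀ k, V k ∈ Matrix.unitaryGroup (Fin 2 × Fin c) ℂ) :
    (∀ b : ℕ, 1 ≤ b →
      opNorm (prodDesc (fun k => multiplexU (θ k) * V k) -
          prodDesc (fun k => multiplexUbar (θ k) b * V k)) ≤
        (n : ℝ) * Real.pi ^ 2 * (2 : ℝ) ^ (-(2 * (b : ℤ) + 1))) ∧
    (∀ ε : ℝ, 0 < ε → ε ≤ (n : ℝ) * Real.pi ^ 2 / 8 →
      opNorm (prodDesc (fun k => multiplexU (θ k) * V k) -
          prodDesc (fun k =>
            multiplexUbar (θ k)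
              ⌈(1 / 2 : ℝ) * Real.logb 2 ((n : ℝ) * Real.pi ^ 2 / (2 * ε))⌉₊ * V k)) ≤
        ε) := by
  refine ⟨fun b _ => main_bound c n θ V hV b, fun ε hε _ => ?_⟩
  refine (main_bound c n θ V hV _).trans ?_
  set b := ⌈(1 / 2 : ℝ) * Real.logb 2 ((n : ℝ) * Real.pi ^ 2 / (2 * ε))⌉₊ with hb
  have hn' : (0 : ℝ) < n := by exact_mod_cast hn
  have hle : (1 / 2 : ℝ) * Real.logb 2 ((n : ℝ) * Real.pi ^ 2 / (2 * ε)) ≤ b := Nat.le_ceil _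
  have hX : 0 < (n : ℝ) * Real.pi ^ 2 / (2 * ε) := by positivity
  have h1 : Real.logb 2 ((n : ℝ) * Real.pi ^ 2 / (2 * ε)) ≤ ((2 * b : ℕ) : ℝ) := by
    push_cast; linarith
  rw [Real.logb_le_iff_le_rpow one_lt_two hX, Real.rpow_natCast, div_le_iff₀ (by positivity)] at h1
  have h2 : (2 : ℝ) ^ (-(2 * (b : ℤ) + 1)) = ((2 : ℝ) ^ (2 * b) * 2)⁻¹ := by
    rw [zpow_neg]
    exact_mod_cast congrArg (fun t : ℝ => t⁻¹) (pow_succ (2 : ℝ) (2 * b))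
  rw [h2, ← div_eq_mul_inv, div_le_iff₀ (by positivity)]
  linarith
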